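/- Let n, m, k ≥ 3 and let T = (t₁,…,tₙ) ∈ ℂⁿ, S = (s₁,…,s_m) ∈ ℂᵐ, R = (r₁,…,r_k) ∈ ℂᵏ be arbitrary tuples. Then the partial compositions ∘ᵢ satisfy the non-symmetric operad axioms proved in the paper: (i) for every i ∈ {1,…,n} and every j ∈ {1,…,m−1}, (T ∘ᵢ S) ∘_{i+j−1} R = T ∘ᵢ (S ∘ⱼ R); and (ii) for all 1 ≤ i < j ≤ n, (T ∘ᵢ S) ∘_{j+m−1} R = (T ∘ⱼ R) ∘ᵢ S. -/

import Mathlib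

/-- The partial composition `T ∘ᵢ S` of two tuples (lists) of complex numbers, with
`1`-based index `i`.  For `1 ≤ i ≤ n-1` (i.e. `i < T.length`) it is
`(t₁,…,t_{i−1}, t_i+s₁+1, s₂,…,s_{m−1}, s_m+1, t_{i+1}+1, t_{i+2},…,tₙ)`,
and for `i = n` it is `(t₁+1, t₂,…,t_{n−1}, tₙ+s₁+1, s₂,…,s_{m−1}, s_m+1)`. -/
noncomputable def qcomp (T S : List ℂ) (i : ℕ) : List ℂ :=
  if i < T.length then
    T.take (i - 1) ++ (T.getD (i - 1) 0 + S.getD 0 0 + 1) ::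
      ((S.drop 1).dropLast ++ (S.getLastD 0 + 1) :: (T.getD i 0 + 1) :: T.drop (i + 1))
  else
    (T.getD 0 0 + 1) :: ((T.drop 1).dropLast ++ (T.getLastD 0 + S.getD 0 0 + 1) ::
      ((S.drop 1).dropLast ++ [S.getLastD 0 + 1]))

theorem length_qcomp {T S : List ℂ} {i : ℕ} (hT : 2 ≤ T.length) (hS : 2 ≤ S.length)
    (hi : 1 ≤ i) : (qcomp T S i).length = T.length + S.length - 1 := by
  unfold qcomp
  split_ifs <;> simp <;> omega

theorem getD_qcomp {T S : List ℂ} {i : ℕ} (hT : 2 ≤ T.length) (hS : 2 ≤ S.length)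
    (hi : 1 ≤ i) (hi' : i ≤ T.length) (p : ℕ) :
    (qcomp T S i).getD p 0 =
      (if p < i then T.getD p 0
        else if p + 1 < i + S.length then 0 else T.getD (p + 1 - S.length) 0) +
      (if i ≤ p + 1 ∧ p + 1 < i + S.length then S.getD (p + 1 - i) 0 else 0) +
      (if p + 1 = i then 1 else 0) + (if p + 2 = i + S.length then 1 else 0) +
      (if i < T.length ∧ p + 1 = i + S.length ∨ i = T.length ∧ p = 0 then 1 else 0) := by
  unfold qcomp
  simp only [List.getD_eq_getElem?_getD, List.getLastD_eq_getLast?, List.getLast?_eq_getElem?]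
  split_ifs <;> grind

/-- Non-symmetric operad axioms for the partial compositions of tuples:
sequential (parallel) associativity for `j ∈ {1,…,m−1}`, and the commutation
axiom for `i < j`. -/
theorem quiddity_operad_axioms (n m k : ℕ) (hn : 3 ≤ n) (hm : 3 ≤ m) (hk : 3 ≤ k)
    (T S R : List ℂ) (hT : T.length = n) (hS : S.length = m) (hR : R.length = k) :
    (∀ i, 1 ≤ i → i ≤ n → ∀ j, 1 ≤ j → j ≤ m - 1 →
      qcomp (qcomp T S i) R (i + j - 1) = qcomp T (qcomp S R j) i) ∧
    (∀ i j, 1 ≤ i → i < j → j ≤ n →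
      qcomp (qcomp T S i) R (j + m - 1) = qcomp (qcomp T R j) S i) := by
  have ext_getD : ∀ {A B : List ℂ}, A.length = B.length →
      (∀ p, A.getD p 0 = B.getD p 0) → A = B := by
    intro A B hl h
    refine List.ext_getElem hl fun p hA hB => ?_
    simpa [hA, hB] using h p
  obtain ⟨s, rfl⟩ := Nat.exists_eq_add_of_le' hm
  obtain ⟨r, rfl⟩ := Nat.exists_eq_add_of_le' hk
  constructor
  · intro i hi hin j hj hjm
    obtain ⟨a, rfl⟩ := Nat.exists_eq_add_of_le' hi
    obtain ⟨b, rfl⟩ := Nat.exists_eq_add_of_le' hj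
    have hbs : b < s + 2 := by omega
    have hab : a + 1 + (b + 1) - 1 = a + b + 1 := by omega
    rw [hab]
    have hTS : (qcomp T S (a + 1)).length = n + s + 2 := by
      rw [length_qcomp (by omega) (by omega) hi]; omega
    have hSR : (qcomp S R (b + 1)).length = s + r + 5 := by
      rw [length_qcomp (by omega) (by omega) hj]; omega
    refine ext_getD ?_ fun p => ?_
    · rw [length_qcomp (T := T) (S := qcomp S R (b + 1)),
        length_qcomp (T := qcomp T S (a + 1))] <;> omega
    · rw [getD_qcomp (T := qcomp T S (a + 1)) (by omega) (by omega) (by omega) (by omega),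
        getD_qcomp (T := T) (S := qcomp S R (b + 1)) (by omega) (by omega) (by omega) (by omega)]
      simp only [getD_qcomp (T := T) (S := S) (i := a + 1) (by omega) (by omega) hi (by omega),
        getD_qcomp (T := S) (S := R) (i := b + 1) (by omega) (by omega) hj (by omega),
        hTS, hSR, hT, hS, hR]
      clear ext_getD hTS hSR hT hS hR hjm hab
      grind (splits := 40)
  · intro i j hi hij hjn
    have hTS : (qcomp T S i).length = n + s + 2 := by
      rw [length_qcomp (by omega) (by omega) hi]; omega
    have hTR : (qcomp T R j).length = n + r + 2 := by
      rw [length_qcomp (by omega) (by omega) (by omega)]; omega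
    have hjs : j + (s + 3) - 1 = j + s + 2 := by omega
    rw [hjs]
    refine ext_getD ?_ fun p => ?_
    · rw [length_qcomp (T := qcomp T S i), length_qcomp (T := qcomp T R j)] <;> omega
    · rw [getD_qcomp (T := qcomp T S i) (by omega) (by omega) (by omega) (by omega),
        getD_qcomp (T := qcomp T R j) (by omega) (by omega) (by omega) (by omega)]
      simp only [getD_qcomp (T := T) (S := S) (i := i) (by omega) (by omega) hi (by omega),
        getD_qcomp (T := T) (S := R) (i := j) (by omega) (by omega) (by omega) (by omega),
        hTS, hTR, hT, hS, hR]
      clear ext_getD hTS hTR hT hS hR hjs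
      grind (splits := 40)
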